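/- There exists an absolute constant c₀ > 0 with the following property. Let X and Y be compact convex subsets of ℝ² with nonempty interiors, and suppose t* ∈ ℝ² realizes the maximum overlap, i.e., area(X ∩ (t* + Y)) = sup_{t ∈ ℝ²} area(X ∩ (t + Y)); set M = X ∩ (t* + Y). Then for every u ∈ ℝ² there exists v ∈ ℝ² such that v + (X ∩ (u + Y)) ⊆ c₀·M, where c₀·M = {c₀·p : p ∈ M}. -/

import Mathlib

open MeasureTheory Pointwise

noncomputable section

abbrev Plane := EuclideanSpace ℝ (Fin 2)

def dt (a b : Plane) : ℝ := a 0 * b 1 - a 1 * b 0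

def unitSq : Set Plane := {x | ∀ i, x i ∈ Set.Icc (0:ℝ) 1}

def par (o e d : Plane) : Set Plane := {x | ∃ s ∈ Set.Icc (0:ℝ) 1, ∃ t ∈ Set.Icc (0:ℝ) 1, x = o + s • e + t • d}

lemma vol_unitSq : volume unitSq = 1 := by
  have h := (PiLp.volume_preserving_ofLp (Fin 2)).measure_preimage
    (s := Set.pi Set.univ (fun _ => Set.Icc (0:ℝ) 1))
    (MeasurableSet.univ_pi (fun _ => measurableSet_Icc)).nullMeasurableSet
  rw [volume_pi_pi] at h
  have e : unitSq = WithLp.ofLp ⁻¹' (Set.univ.pi fun _ => Set.Icc (0:ℝ) 1) := by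
    ext x
    simp only [unitSq, Set.mem_ofPred_eq, Set.mem_preimage, Set.mem_univ_pi]
  rw [e, h]
  simp

lemma vol_par (o e d : Plane) : volume (par o e d) = ENNReal.ofReal |dt e d| := by
  let A : Matrix (Fin 2) (Fin 2) ℝ := !![e 0, d 0; e 1, d 1]
  let f : Plane →ₗ[ℝ] Plane := Matrix.toLin (EuclideanSpace.basisFun (Fin 2) ℝ).toBasis (EuclideanSpace.basisFun (Fin 2) ℝ).toBasis A
  have hf : ∀ x : Plane, f x = x 0 • e + x 1 • d := by
    intro x
    ext i
    fin_cases i <;> simp [f, A, Matrix.toLin_apply, Matrix.mulVec, dotProduct, Fin.sum_univ_two] <;> ring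
  have hdet : LinearMap.det f = dt e d := by
    simp only [f, LinearMap.det_toLin, A, Matrix.det_fin_two_of, dt]
    ring
  have : par o e d = o +ᵥ (f '' unitSq) := by
    ext x
    simp only [par, Set.mem_ofPred_eq, Set.mem_vadd_set, Set.mem_image]
    constructor
    · rintro ⟨s, hs, t, ht, rfl⟩
      refine ⟨_, ⟨!₂[s, t], ?_, rfl⟩, ?_⟩
      · intro i; fin_cases i <;> simpa
      · rw [hf]; simp [add_assoc]
    · rintro ⟨_, ⟨y, hy, rfl⟩, rfl⟩
      exact ⟨y 0, hy 0, y 1, hy 1, by rw [hf]; simp [add_assoc]⟩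
  rw [this, measure_vadd, Measure.addHaar_image_linearMap, vol_unitSq, hdet, mul_one]

lemma decomp (e d x : Plane) (h : dt e d ≠ 0) :
    x = (dt x d / dt e d) • e + (dt e x / dt e d) • d := by
  ext i
  have : dt e d * x i = dt x d * e i + dt e x * d i := by
    fin_cases i <;> simp [dt] <;> ring
  simp only [PiLp.add_apply, PiLp.smul_apply, smul_eq_mul]
  field_simp
  linarith

lemma dt_cont : Continuous (fun p : Plane × Plane × Plane => |dt (p.2.1 - p.1) (p.2.2 - p.1)|) := by
  unfold dt
  simp only [PiLp.sub_apply]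
  fun_prop

/-- A maximal triangle. -/
lemma exists_tri (M : Set Plane) (hM : IsCompact M) (hi : (interior M).Nonempty) :
    ∃ o ∈ M, ∃ p ∈ M, ∃ q ∈ M, dt (p - o) (q - o) ≠ 0 ∧
      ∀ a ∈ M, ∀ b ∈ M, ∀ c ∈ M, |dt (b - a) (c - a)| ≤ |dt (p - o) (q - o)| := by
  obtain ⟨z, hz⟩ := hi
  obtain ⟨⟨o, p, q⟩, ⟨ho, hp, hq⟩, hmax⟩ := (hM.prod (hM.prod hM)).exists_isMaxOn
    ⟨(z, z, z), interior_subset hz, interior_subset hz, interior_subset hz⟩ dt_cont.continuousOn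
  have hmax' : ∀ a ∈ M, ∀ b ∈ M, ∀ c ∈ M, |dt (b - a) (c - a)| ≤ |dt (p - o) (q - o)| :=
    fun a ha b hb c hc => hmax (show (a, b, c) ∈ M ×ˢ M ×ˢ M from ⟨ha, hb, hc⟩)
  refine ⟨o, ho, p, hp, q, hq, ?_, hmax'⟩
  obtain ⟨r, hr, hball⟩ := Metric.isOpen_iff.1 isOpen_interior z hz
  have key : ∀ i, z + EuclideanSpace.single i (r/2) ∈ M := by
    intro i
    apply interior_subset
    apply hball
    simp [abs_of_pos hr]
    linarith
  have := hmax' z (interior_subset hz) _ (key 0) _ (key 1)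
  intro h0
  rw [h0] at this
  simp [dt] at this
  nlinarith

lemma vol_le (M : Set Plane) (o e d : Plane) (h : dt e d ≠ 0)
    (h1 : ∀ x ∈ M, |dt e (x - o)| ≤ |dt e d|) (h2 : ∀ x ∈ M, |dt (x - o) d| ≤ |dt e d|) :
    volume M ≤ ENNReal.ofReal (4 * |dt e d|) := by
  have hs : M ⊆ par (o - e - d) ((2:ℝ) • e) ((2:ℝ) • d) := by
    intro x hx
    have h1 := h1 x hx
    have h2 := h2 x hx
    have hd := decomp e d (x - o) h
    have a1 : |dt e (x - o) / dt e d| ≤ 1 := by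
      rw [abs_div]; exact div_le_one_of_le₀ h1 (abs_nonneg _)
    have a2 : |dt (x - o) d / dt e d| ≤ 1 := by
      rw [abs_div]; exact div_le_one_of_le₀ h2 (abs_nonneg _)
    rw [abs_le] at a1 a2
    generalize dt e (x - o) / dt e d = β at *
    generalize dt (x - o) d / dt e d = α at *
    refine ⟨(α+1)/2, ⟨by linarith, by linarith⟩, (β+1)/2, ⟨by linarith, by linarith⟩, ?_⟩
    rw [sub_eq_iff_eq_add.1 hd]
    module
  refine (measure_mono hs).trans ?_
  rw [vol_par]
  apply le_of_eq
  congr 1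
  rw [show dt ((2:ℝ) • e) ((2:ℝ) • d) = 4 * dt e d by simp [dt]; ring, abs_mul]
  norm_num

theorem max_overlap_contains_all_overlaps :
    ∃ c₀ : ℝ, 0 < c₀ ∧
      ∀ X Y : Set Plane,
        IsCompact X → Convex ℝ X → (interior X).Nonempty →
        IsCompact Y → Convex ℝ Y → (interior Y).Nonempty →
        ∀ tstar : Plane,
          volume (X ∩ (tstar +ᵥ Y)) = ⨆ t : Plane, volume (X ∩ (t +ᵥ Y)) →
          ∀ u : Plane, ∃ v : Plane,
            v +ᵥ (X ∩ (u +ᵥ Y)) ⊆ c₀ • (X ∩ (tstar +ᵥ Y)) := by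
  refine ⟨64, by norm_num, ?_⟩
  intro X Y hXc hX ⟨x0, hx0⟩ hYc hY ⟨y0, hy0⟩ ts hts u
  have hle : ∀ t : Plane, volume (X ∩ (t +ᵥ Y)) ≤ volume (X ∩ (ts +ᵥ Y)) := by
    intro t; rw [hts]; exact le_iSup (fun t : Plane => volume (X ∩ (t +ᵥ Y))) t
  have hmem : ∀ (t x : Plane), x ∈ t +ᵥ Y ↔ x - t ∈ Y := by
    intro t x
    rw [Set.mem_vadd_set_iff_neg_vadd_mem, vadd_eq_add, neg_add_eq_sub]
  set M := X ∩ (ts +ᵥ Y) with hMdef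
  have hMc : IsCompact M := hXc.inter (hYc.vadd ts)
  have hMconv : Convex ℝ M := hX.inter (hY.vadd ts)
  have hpos : 0 < volume M := by
    refine lt_of_lt_of_le ?_ (hle (x0 - y0))
    have : IsOpen (interior X ∩ ((x0 - y0) +ᵥ interior Y)) :=
      isOpen_interior.inter (isOpen_interior.vadd _)
    refine lt_of_lt_of_le (this.measure_pos volume ⟨x0, hx0, y0, hy0, by simp⟩) ?_
    exact measure_mono (Set.inter_subset_inter interior_subset
      (Set.vadd_set_mono interior_subset))
  have hint : (interior M).Nonempty := by
    by_contra hne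
    rw [Set.not_nonempty_iff_eq_empty] at hne
    have h0 := hMconv.addHaar_frontier volume
    rw [frontier, hne, Set.sdiff_empty, hMc.isClosed.closure_eq] at h0
    exact hpos.ne' h0
  obtain ⟨o, ho, p, hp, q, hq, hD, hmax⟩ := exists_tri M hMc hint
  have hvol : volume M ≤ ENNReal.ofReal (4 * |dt (p - o) (q - o)|) :=
    vol_le M o (p - o) (q - o) hD (fun x hx => hmax o ho p hp x hx)
      (fun x hx => hmax o ho x hx q hq)
  -- parallelogram inside a midway overlap
  have hpar : ∀ a ∈ X ∩ (u +ᵥ Y), ∀ b ∈ X ∩ (u +ᵥ Y), ∀ r ∈ M,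
      |dt (r - o) (b - a)| ≤ 16 * |dt (p - o) (q - o)| := by
    intro a ha b hb r hr
    have hK : Convex ℝ (X ∩ (u +ᵥ Y)) := hX.inter (hY.vadd u)
    have hsub : par ((1/2:ℝ) • o + (1/2:ℝ) • a) ((1/2:ℝ) • (r - o)) ((1/2:ℝ) • (b - a)) ⊆
        X ∩ (((1/2:ℝ) • ts + (1/2:ℝ) • u) +ᵥ Y) := by
      rintro _ ⟨s, hs, t, ht, rfl⟩
      have m1 : o + s • (r - o) ∈ M := hMconv.add_smul_sub_mem ho hr hs
      have m2 : a + t • (b - a) ∈ X ∩ (u +ᵥ Y) := hK.add_smul_sub_mem ha hb ht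
      constructor
      · have := hX m1.1 m2.1 (show (0:ℝ) ≤ 1/2 by norm_num) (show (0:ℝ) ≤ 1/2 by norm_num)
          (by norm_num)
        convert this using 1
        module
      · rw [hmem]
        have := hY ((hmem _ _).1 m1.2) ((hmem _ _).1 m2.2) (show (0:ℝ) ≤ 1/2 by norm_num)
          (show (0:ℝ) ≤ 1/2 by norm_num) (by norm_num)
        convert this using 1
        module
    have h := (measure_mono hsub).trans ((hle _).trans hvol)
    rw [vol_par, ENNReal.ofReal_le_ofReal_iff (by positivity),
      show dt ((1/2:ℝ) • (r - o)) ((1/2:ℝ) • (b - a)) = 1/4 * dt (r - o) (b - a) by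
        simp [dt]; ring, abs_mul, abs_of_pos (show (0:ℝ) < 1/4 by norm_num)] at h
    linarith
  by_cases hKe : (X ∩ (u +ᵥ Y)).Nonempty
  swap
  · rw [Set.not_nonempty_iff_eq_empty] at hKe
    rw [hKe]; exact ⟨0, by simp⟩
  obtain ⟨a, ha⟩ := hKe
  refine ⟨(64:ℝ) • o + (16:ℝ) • (p - o) + (16:ℝ) • (q - o) - a, ?_⟩
  rintro _ ⟨b, hb, rfl⟩
  have hd := decomp (p - o) (q - o) (b - a) hD
  have a1 : |dt (p - o) (b - a) / dt (p - o) (q - o)| ≤ 16 := by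
    rw [abs_div, div_le_iff₀ (abs_pos.2 hD)]
    exact hpar a ha b hb p hp
  have a2 : |dt (b - a) (q - o) / dt (p - o) (q - o)| ≤ 16 := by
    rw [abs_div, div_le_iff₀ (abs_pos.2 hD),
      show dt (b - a) (q - o) = - dt (q - o) (b - a) by simp [dt]; ring, abs_neg]
    exact hpar a ha b hb q hq
  rw [abs_le] at a1 a2
  generalize dt (p - o) (b - a) / dt (p - o) (q - o) = β at *
  generalize dt (b - a) (q - o) / dt (p - o) (q - o) = α at *
  have hb' := sub_eq_iff_eq_add.1 hd
  refine ⟨(1 - (16+α)/64 - (16+β)/64) • o + ((16+α)/64) • p + ((16+β)/64) • q, ?_, ?_⟩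
  · have := hMconv.sum_mem (t := Finset.univ)
      (w := ![1 - (16+α)/64 - (16+β)/64, (16+α)/64, (16+β)/64]) (z := ![o, p, q])
      (by intro i _; fin_cases i <;> simp <;> linarith)
      (by simp [Fin.sum_univ_three]; ring)
      (by intro i _; fin_cases i <;> simpa)
    simpa [Fin.sum_univ_three] using this
  · simp only [vadd_eq_add]
    rw [hb']
    module
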